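/- arXiv:1701.05215 — 3 statements merged into one kernel-verified Lean document; each statement's English description precedes it below -/
import Mathlib

section
/- Let T be a tree with n > 8 vertices, u ∈ CT(T) and v ∈ Core(T) with d(u,v) = d(CT(T), Core(T)) ≥ 1. Let T_u and T_v be the components containing u and v in T with the edges of the path P(u,v) removed, and let y = |V(T_v)|. Then 2^(y−1) > n − y. -/
open SimpleGraph Finset

/-- Eccentricity of a vertex: max distance to any vertex. -/
noncomputable def ecc {V : Type*} [Fintype V] (G : SimpleGraph V) (v : V) : ℕ :=
  Finset.univ.sup (fun u => G.dist v u)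

/-- The center: vertices of minimum eccentricity. -/
noncomputable def center {V : Type*} [Fintype V] (G : SimpleGraph V) : Set V :=
  {v | ∀ u, ecc G v ≤ ecc G u}

/-- Total distance of a vertex. -/
noncomputable def totalDist {V : Type*} [Fintype V] (G : SimpleGraph V) (v : V) : ℕ :=
  ∑ u, G.dist v u

/-- The centroid: vertices of minimum total distance. -/
noncomputable def centroid {V : Type*} [Fintype V] (G : SimpleGraph V) : Set V :=
  {v | ∀ u, totalDist G v ≤ totalDist G u}

/-- Number of subtrees (connected induced subgraphs on nonempty vertex sets) containing `v`. -/
noncomputable def subtreeCount {V : Type*} [Fintype V] (G : SimpleGraph V) (v : V) : ℕ :=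
  Nat.card {A : Finset V // v ∈ A ∧ (G.induce (A : Set V)).Connected}

/-- The subtree core: vertices maximizing the number of containing subtrees. -/
noncomputable def core {V : Type*} [Fintype V] (G : SimpleGraph V) : Set V :=
  {v | ∀ u, subtreeCount G u ≤ subtreeCount G v}

/-- Distance between two sets of vertices. -/
noncomputable def setDist {V : Type*} (G : SimpleGraph V) (S S' : Set V) : ℕ :=
  sInf {n | ∃ u ∈ S, ∃ v ∈ S', G.dist u v = n}

/-- Two paths with the same ends in an acyclic graph are equal. -/
theorem eq_of_isAcyclic_of_isPath {V : Type*} {G : SimpleGraph V} (hG : G.IsAcyclic) {a b : V}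
    {r r' : G.Walk a b} (hr : r.IsPath) (hr' : r'.IsPath) : r = r' :=
  congrArg Subtype.val ((hG.subsingleton_path a b).elim ⟨r, hr⟩ ⟨r', hr'⟩)

/-- If `v` has a neighbour `w` next on a path to `u`, then a path from `v` avoiding `w` survives
the deletion of the edges of that path. -/
theorem reachable_deleteEdges_of_notMem_support {V : Type*} {G : SimpleGraph V}
    (hT : G.IsTree) {u v w s : V} (h : G.Adj v w) {q : G.Walk w u} (hq : (Walk.cons h q).IsPath)
    {r : G.Walk v s} (hr : r.IsPath) (hw : w ∉ r.support) :
    (G.deleteEdges {e | e ∈ (Walk.cons h q).edges}).Reachable v s := by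
  classical
  have hr' : ∀ e ∈ r.edges, e ∉ {e | e ∈ (Walk.cons h q).edges} := by
    intro e her heq
    induction e using Sym2.ind with
    | _ x z =>
    have hz := Walk.snd_mem_support_of_mem_edges _ her
    have hx := Walk.fst_mem_support_of_mem_edges _ her
    rcases List.mem_cons.1 (by simpa only [Set.mem_ofPred_eq, Walk.edges_cons] using heq) with h1 | h1
    · rcases Sym2.eq_iff.1 h1 with ⟨rfl, rfl⟩ | ⟨rfl, rfl⟩
      · exact hw hz
      · exact hw hx
    · have hxq := Walk.fst_mem_support_of_mem_edges _ h1
      rw [Walk.cons_isPath_iff] at hq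
      have hp : (Walk.cons h (q.takeUntil x hxq)).IsPath := by
        rw [Walk.cons_isPath_iff]
        exact ⟨hq.1.takeUntil hxq, fun hv => hq.2 (q.support_takeUntil_subset_support hxq hv)⟩
      apply hw
      apply r.support_takeUntil_subset_support hx
      rw [← eq_of_isAcyclic_of_isPath hT.isAcyclic hp (hr.takeUntil hx)]
      simp
  exact ⟨r.toDeleteEdges _ hr'⟩

/-- A connected induced subgraph containing `v` and avoiding `w` lies in the component of `v`. -/
theorem subset_supp_of_connected_induce {V : Type*} {G : SimpleGraph V}
    (hT : G.IsTree) {u v w : V} (h : G.Adj v w) {q : G.Walk w u} (hq : (Walk.cons h q).IsPath)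
    {S : Set V} (hv : v ∈ S) (hw : w ∉ S) (hS : (G.induce S).Connected) :
    S ⊆ ((G.deleteEdges {e | e ∈ (Walk.cons h q).edges}).connectedComponentMk v).supp := by
  classical
  intro s hs
  obtain ⟨r⟩ := hS.preconnected ⟨v, hv⟩ ⟨s, hs⟩
  have hsub : w ∉ (r.map (Embedding.induce S).toHom).support := by
    rw [Walk.support_map]
    intro hmem
    obtain ⟨x, -, hx⟩ := List.mem_map.1 hmem
    exact hw (hx ▸ x.2)
  have hreach := reachable_deleteEdges_of_notMem_support hT h hq
    (r.map (Embedding.induce S).toHom).bypass_isPath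
    (fun hmem => hsub (Walk.support_bypass_subset_support _ hmem))
  exact ConnectedComponent.sound hreach.symm

/-- The path from `w` to a vertex outside the component of `v` avoids `v`. -/
theorem notMem_support_of_notMem_supp {V : Type*} {G : SimpleGraph V}
    (hT : G.IsTree) {u v w a : V} (h : G.Adj v w) {q : G.Walk w u} (hq : (Walk.cons h q).IsPath)
    (ha : a ∉ ((G.deleteEdges {e | e ∈ (Walk.cons h q).edges}).connectedComponentMk v).supp)
    {r : G.Walk w a} (hr : r.IsPath) : v ∉ r.support := by
  classical
  intro hv
  apply ha
  have hedge : (Walk.cons h.symm Walk.nil).IsPath := by simp [h.ne']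
  have heq := eq_of_isAcyclic_of_isPath hT.isAcyclic hedge (hr.takeUntil hv)
  have hspec := r.take_spec hv
  rw [← heq, Walk.cons_append, Walk.nil_append] at hspec
  rw [← hspec, Walk.cons_isPath_iff] at hr
  exact ConnectedComponent.sound
    (reachable_deleteEdges_of_notMem_support hT h hq hr.1 hr.2).symm

/-- In an acyclic graph, paths from a common vertex with the same vertex set have the same end. -/
theorem end_eq_of_toFinset_support_eq {V : Type*} [DecidableEq V] {G : SimpleGraph V}
    (hG : G.IsAcyclic) {w a b : V} {r : G.Walk w a} {r' : G.Walk w b} (hr : r.IsPath)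
    (hr' : r'.IsPath) (h : r.support.toFinset = r'.support.toFinset) : a = b := by
  by_contra hab
  have ha : a ∈ r'.support := by
    rw [← List.mem_toFinset, ← h]
    simp
  have heq := eq_of_isAcyclic_of_isPath hG hr (hr'.takeUntil ha)
  have hlt := Walk.length_takeUntil_lt_length ha hab
  have hcard := congrArg Finset.card h
  rw [List.toFinset_card_of_nodup hr.support_nodup, List.toFinset_card_of_nodup hr'.support_nodup,
    Walk.length_support, Walk.length_support, congrArg Walk.length heq] at hcard
  omega

theorem card_compl_supp_lt_two_pow {V : Type*} [Fintype V] {G : SimpleGraph V}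
    (hT : G.IsTree) {u v w : V} (h : G.Adj v w) {q : G.Walk w u} (hq : (Walk.cons h q).IsPath)
    (hlt : subtreeCount G w < subtreeCount G v) :
    Fintype.card V -
        ((G.deleteEdges {e | e ∈ (Walk.cons h q).edges}).connectedComponentMk v).supp.ncard <
      2 ^ (((G.deleteEdges
        {e | e ∈ (Walk.cons h q).edges}).connectedComponentMk v).supp.ncard - 1) := by
  classical
  set B := ((G.deleteEdges {e | e ∈ (Walk.cons h q).edges}).connectedComponentMk v).supp with hB
  let C : V → Finset (Finset V) := fun x =>
    Finset.univ.filter fun A => x ∈ A ∧ (G.induce (A : Set V)).Connected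
  have hC : ∀ x, subtreeCount G x = (C x).card := fun x => by
    rw [subtreeCount, Nat.card_eq_fintype_card, Fintype.card_subtype]
  rw [hC, hC] at hlt
  have hsdiff : (C w \ C v).card < (C v \ C w).card := by
    have h1 := Finset.card_sdiff_add_card_inter (C w) (C v)
    have h2 := Finset.card_sdiff_add_card_inter (C v) (C w)
    rw [Finset.inter_comm] at h2
    omega
  have hvB : v ∈ B.toFinset := by simp [hB]
  have hupper : (C v \ C w).card ≤ 2 ^ (B.ncard - 1) := by
    rw [Set.ncard_eq_toFinset_card', ← Finset.card_erase_of_mem hvB, ← Finset.card_powerset]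
    have hmem : ∀ S ∈ C v \ C w, v ∈ S ∧ w ∉ S ∧ (G.induce (S : Set V)).Connected := by
      intro S hS
      simp only [C, Finset.mem_sdiff, Finset.mem_filter, Finset.mem_univ, true_and] at hS
      tauto
    refine Finset.card_le_card_of_injOn (fun S => S.erase v) (fun S hS => ?_) ?_
    · obtain ⟨h1, h2, h3⟩ := hmem S hS
      rw [Finset.mem_coe, Finset.mem_powerset]
      refine Finset.erase_subset_erase _ fun x hx => ?_
      exact Set.mem_toFinset.2 (subset_supp_of_connected_induce hT h hq (S := (S : Set V))
        h1 h2 h3 hx)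
    · intro S hS S' hS' heq
      rw [← Finset.insert_erase (hmem S hS).1, ← Finset.insert_erase (hmem S' hS').1]
      exact congrArg (insert v) heq
  have hlower : Fintype.card V - B.ncard ≤ (C w \ C v).card := by
    rw [Set.ncard_eq_toFinset_card', ← Finset.card_compl]
    choose r hr using fun a => (hT.connected w a).exists_isPath
    refine Finset.card_le_card_of_injOn (fun a => (r a).support.toFinset) (fun a ha => ?_) ?_
    · have ha' : a ∉ B := by simpa using ha
      have hv := notMem_support_of_notMem_supp hT h hq ha' (hr a)
      have hconn := (r a).connected_induce_support
      have hset : (((r a).support.toFinset : Finset V) : Set V) = {x | x ∈ (r a).support} := by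
        ext; simp
      simp only [C, Finset.coe_sdiff, Set.mem_sdiff, Finset.mem_coe, Finset.mem_filter,
        Finset.mem_univ, true_and, List.mem_toFinset, hv, false_and, not_false_eq_true, and_true]
      refine ⟨(r a).start_mem_support, ?_⟩
      rw [hset]
      exact hconn
    · intro a _ b _ heq
      exact end_eq_of_toFinset_support_eq hT.isAcyclic (hr a) (hr b) heq
  omega

/-- with `u ∈ CT(T)`, `v ∈ Core(T)` realizing the distance between
centroid and core, and `y` the order of the component of `v` after deleting the
edges of the path `P(u,v)`, we have `2^(y-1) > n - y`. -/
theorem core_component_large {V : Type*} [Fintype V] (G : SimpleGraph V)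
    (hT : G.IsTree) (n : ℕ) (hn : n = Fintype.card V) (h8 : 8 < n)
    (u v : V) (hu : u ∈ centroid G) (hv : v ∈ core G)
    (hd : G.dist u v = setDist G (centroid G) (core G)) (hd1 : 1 ≤ G.dist u v)
    (p : G.Walk u v) (hp : p.IsPath)
    (y : ℕ)
    (hy : y = (((G.deleteEdges {e | e ∈ p.edges}).connectedComponentMk v).supp).ncard) :
    n - y < 2 ^ (y - 1) := by
  subst hn hy
  have hrev : p.reverse.IsPath := hp.reverse
  have hedges : {e | e ∈ p.edges} = {e | e ∈ p.reverse.edges} := by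
    ext e
    simp
  rw [hedges]
  generalize p.reverse = p' at hrev
  cases p' with
  | nil => simp at hd1
  | @cons _ w _ h q =>
    refine card_compl_supp_lt_two_pow hT h hrev (lt_of_le_of_ne (hv w) fun heq => ?_)
    have hw : w ∈ core G := fun x => heq ▸ hv x
    have hle : setDist G (centroid G) (core G) ≤ G.dist u w := Nat.sInf_le ⟨u, hu, w, hw, rfl⟩
    have hlen : G.dist u v = (Walk.cons h q).length := by
      rw [G.dist_comm]
      obtain ⟨r, hr, hr'⟩ := (hT.connected v u).exists_path_of_dist
      rw [← hr']
      exact congrArg Walk.length (eq_of_isAcyclic_of_isPath hT.isAcyclic hr hrev)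
    have hq := G.dist_le q
    rw [Walk.length_cons] at hlen
    rw [G.dist_comm] at hq
    omega
end

section
/- Let T be a rooted tree of order n with every leaf at height exactly h. Suppose T minimizes the number of root-containing subtrees among all rooted trees of order n and height at most h. Then for every vertex v of T, the subtree T(v) induced by v and its descendants minimizes the number of subtrees containing v among all rooted trees of order |V(T(v))| and height at most h − h_T(v). -/
open SimpleGraph Finset

namespace SimpleGraph

variable {V W : Type*} {G : SimpleGraph V} {H : SimpleGraph W}

/-- A walk is mapped to a walk that is no longer by a map sending adjacent vertices to
adjacent or equal ones. -/
lemma Walk.exists_length_le_of_contraction (f : V → W)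
    (hf : ∀ x y, G.Adj x y → f x = f y ∨ H.Adj (f x) (f y)) {x y : V} (p : G.Walk x y) :
    ∃ q : H.Walk (f x) (f y), q.length ≤ p.length := by
  induction p with
  | nil => exact ⟨.nil, le_rfl⟩
  | cons h p ih =>
    obtain ⟨q, hq⟩ := ih
    rcases hf _ _ h with h' | h'
    · exact ⟨q.copy h'.symm rfl, by simp; omega⟩
    · exact ⟨.cons h' q, by simpa using hq⟩

lemma Reachable.of_contraction (f : V → W)
    (hf : ∀ x y, G.Adj x y → f x = f y ∨ H.Adj (f x) (f y)) {x y : V} (h : G.Reachable x y) :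
    H.Reachable (f x) (f y) := by
  obtain ⟨p⟩ := h
  obtain ⟨q, -⟩ := p.exists_length_le_of_contraction f hf
  exact ⟨q⟩

lemma Connected.dist_le_of_contraction (hG : G.Connected) (f : V → W)
    (hf : ∀ x y, G.Adj x y → f x = f y ∨ H.Adj (f x) (f y)) (x y : V) :
    H.dist (f x) (f y) ≤ G.dist x y := by
  obtain ⟨p, hp⟩ := hG.exists_walk_length_eq_dist x y
  obtain ⟨q, hq⟩ := p.exists_length_le_of_contraction f hf
  exact (H.dist_le q).trans (hp ▸ hq)

lemma Connected.of_contraction (hG : G.Connected) (f : V → W) (hsurj : f.Surjective)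
    (hf : ∀ x y, G.Adj x y → f x = f y ∨ H.Adj (f x) (f y)) : H.Connected := by
  have := hG.nonempty.map f
  refine ⟨fun a b => ?_⟩
  obtain ⟨x, rfl⟩ := hsurj a
  obtain ⟨y, rfl⟩ := hsurj b
  exact (hG x y).of_contraction f hf

lemma Connected.induce_congr {s t : Set V} (hs : (G.induce s).Connected) (h : s = t) :
    (G.induce t).Connected := h ▸ hs

/-- In a tree, a vertex has at most one neighbour closer to the root. -/
lemma IsTree.eq_of_adj_of_dist (hG : G.IsTree) {r x x' y : V} (hx : G.Adj x y)
    (hx' : G.Adj x' y) (h : G.dist r x + 1 = G.dist r y) (h' : G.dist r x' + 1 = G.dist r y) :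
    x = x' := by
  obtain ⟨p, hp⟩ := hG.connected.exists_walk_length_eq_dist r x
  obtain ⟨q, hq⟩ := hG.connected.exists_walk_length_eq_dist r x'
  have hp' := (p.concat hx).isPath_of_length_eq_dist (by simp; omega)
  have hq' := (q.concat hx').isPath_of_length_eq_dist (by simp; omega)
  have := (hG.existsUnique_path r y).unique hp' hq'
  simpa using congrArg Walk.penultimate this

lemma Connected.exists_adj_dist_add_one_eq (hG : G.Connected) {r y : V} (h : y ≠ r) :
    ∃ x, G.Adj x y ∧ G.dist r x + 1 = G.dist r y := by
  obtain ⟨p, hp⟩ := hG.exists_walk_length_eq_dist y r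
  cases p with
  | nil => exact absurd rfl h
  | @cons _ x _ hyx p =>
    refine ⟨x, hyx.symm, ?_⟩
    rw [Walk.length_cons, dist_comm] at hp
    have h1 := G.dist_le p
    rw [dist_comm] at h1
    have h2 := hG.dist_triangle (u := r) (v := x) (w := y)
    rw [dist_eq_one_iff_adj.2 hyx.symm] at h2
    omega

/-- `D` hangs from the rest of the graph by the single edge from `p` outside to `v` inside. -/
structure IsHanging (G : SimpleGraph V) (D : Set V) (p v : V) : Prop where
  notMem : p ∉ D
  mem : v ∈ D
  adj : G.Adj p v
  eq_and_eq : ∀ x y, x ∉ D → y ∈ D → G.Adj x y → x = p ∧ y = v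

lemma IsTree.isHanging_descendants (hG : G.IsTree) {r p v : V} (hpv : G.Adj p v)
    (hp : G.dist r p + 1 = G.dist r v) :
    G.IsHanging {w | G.dist r w = G.dist r v + G.dist v w} p v := by
  refine ⟨by simp; omega, by simp, hpv, fun x y hx hy hxy => ?_⟩
  simp only [Set.mem_ofPred_eq] at hx hy
  have tri := fun a => hG.connected.dist_triangle (u := r) (v := v) (w := a)
  have hyx : G.dist r x + 1 = G.dist r y := by
    rcases hG.dist_eq_dist_add_one_of_adj r hxy with h | h
    · have h1 := hG.connected.dist_triangle (u := v) (v := y) (w := x)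
      rw [dist_eq_one_iff_adj.2 hxy.symm] at h1
      have := tri x
      omega
    · exact h.symm
  by_cases hyv : y = v
  · subst hyv
    exact ⟨hG.eq_of_adj_of_dist hxy hpv hyx hp, rfl⟩
  · obtain ⟨z, hzy, hz⟩ := hG.connected.exists_adj_dist_add_one_eq hyv
    have h1 := tri z
    have h2 := hG.connected.dist_triangle (u := r) (v := z) (w := y)
    rw [dist_eq_one_iff_adj.2 hzy] at h2
    have hzx := hG.eq_of_adj_of_dist (r := r) hzy hxy (by omega) hyx
    subst hzx
    omega

namespace IsHanging

variable {D : Set V} {p v : V}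

lemma eq_and_eq' (hD : G.IsHanging D p v) {x y : V} (hx : x ∈ D) (hy : y ∉ D)
    (h : G.Adj x y) : y = p ∧ x = v := hD.eq_and_eq y x hy hx h.symm

lemma mem_and_mem_of_connected (hD : G.IsHanging D p v) {A : Set V}
    (hA : (G.induce A).Connected) {r d : V} (hr : r ∈ A) (hrD : r ∉ D) (hd : d ∈ A)
    (hdD : d ∈ D) : p ∈ A ∧ v ∈ A := by
  obtain ⟨w⟩ := hA ⟨r, hr⟩ ⟨d, hd⟩
  obtain ⟨⟨⟨⟨x, hx⟩, ⟨y, hy⟩⟩, hxy⟩, -, h1, h2⟩ :=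
    w.exists_boundary_dart {a | (a : V) ∉ D} hrD (by simpa using hdD)
  obtain ⟨rfl, rfl⟩ := hD.eq_and_eq x y h1 (by simpa using h2) hxy
  exact ⟨hx, hy⟩

lemma connected_diff (hD : G.IsHanging D p v) {A : Set V} (hA : (G.induce A).Connected)
    (hp : p ∈ A) : (G.induce {x | x ∈ A ∧ x ∉ D}).Connected := by
  classical
  refine hA.of_contraction
    (fun x => if hx : (x : V) ∈ D then ⟨p, hp, hD.notMem⟩ else ⟨x, x.2, hx⟩) ?_ ?_
  · rintro ⟨x, hx, hxD⟩
    exact ⟨⟨x, hx⟩, by simp [hxD]⟩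
  · rintro ⟨x, hx⟩ ⟨y, hy⟩ hxy
    have hxy' : G.Adj x y := hxy
    by_cases h1 : x ∈ D <;> by_cases h2 : y ∈ D
    · simp [h1, h2]
    · simp [h1, (hD.eq_and_eq' h1 h2 hxy').1]
    · simp [h2, (hD.eq_and_eq x y h1 h2 hxy').1]
    · simp [h1, h2, hxy']

lemma connected_inter (hD : G.IsHanging D p v) {A : Set V} (hA : (G.induce A).Connected)
    (hv : v ∈ A) : ((G.induce D).induce {x : D | (x : V) ∈ A}).Connected := by
  classical
  refine hA.of_contraction
    (fun x => if hx : (x : V) ∈ D then ⟨⟨x, hx⟩, x.2⟩ else ⟨⟨v, hD.mem⟩, hv⟩) ?_ ?_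
  · rintro ⟨⟨x, hxD⟩, hx⟩
    exact ⟨⟨x, hx⟩, by simp [hxD]⟩
  · rintro ⟨x, hx⟩ ⟨y, hy⟩ hxy
    have hxy' : G.Adj x y := hxy
    by_cases h1 : x ∈ D <;> by_cases h2 : y ∈ D
    · simp [h1, h2, hxy']
    · simp [h2, (hD.eq_and_eq' h1 h2 hxy').2]
    · simp [h1, (hD.eq_and_eq x y h1 h2 hxy').2]
    · simp [h1, h2]

lemma connected_union (hD : G.IsHanging D p v) {B : Set V} {C : Set D}
    (hB : (G.induce B).Connected) (hp : p ∈ B) (hC : ((G.induce D).induce C).Connected)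
    (hv : ⟨v, hD.mem⟩ ∈ C) : (G.induce (B ∪ Subtype.val '' C)).Connected := by
  have hC' : (G.induce (Subtype.val '' C)).Connected := by
    refine hC.of_contraction (fun x => ⟨x.1.1, x.1, x.2, rfl⟩) ?_ ?_
    · rintro ⟨_, x, hx, rfl⟩
      exact ⟨⟨x, hx⟩, rfl⟩
    · exact fun x y h => Or.inr h
  exact connected_induce_union hB.preconnected hC'.preconnected hp ⟨_, hv, rfl⟩ hD.adj

end IsHanging

end SimpleGraph

lemma subtreeCount_congr {V W : Type*} [Fintype V] [Fintype W] {G : SimpleGraph V}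
    {H : SimpleGraph W} (φ : G ≃g H) (v : V) : subtreeCount G v = subtreeCount H (φ v) := by
  refine Nat.card_congr (φ.toEquiv.finsetCongr.subtypeEquiv fun A => ?_)
  refine and_congr ?_ (φ.induce ?_).connected_iff
  · exact (Finset.mem_map' φ.toEquiv.toEmbedding).symm
  · rw [Equiv.finsetCongr_apply, Finset.coe_map]
    exact φ.injective.injOn.bijOn_image

/-- Root-containing subtrees either avoid a hanging set, or split into a part outside and a part
inside. -/
lemma SimpleGraph.IsHanging.subtreeCount_eq {V : Type*} [Fintype V] {G : SimpleGraph V}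
    {D : Set V} [Fintype D] {p v r : V} (hD : G.IsHanging D p v) (hr : r ∉ D) :
    subtreeCount G r =
      Nat.card {A : Finset V // (r ∈ A ∧ ∀ x ∈ A, x ∉ D) ∧ (G.induce (A : Set V)).Connected} +
      Nat.card {A : Finset V // (r ∈ A ∧ p ∈ A ∧ ∀ x ∈ A, x ∉ D) ∧
        (G.induce (A : Set V)).Connected} * subtreeCount (G.induce D) ⟨v, hD.mem⟩ := by
  classical
  simp only [subtreeCount, Nat.card_eq_fintype_card, Fintype.card_subtype]
  rw [← Finset.card_product,
    ← Finset.card_filter_add_card_filter_not (fun A : Finset V => ∀ x ∈ A, x ∉ D)]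
  congr 1
  · rw [Finset.filter_filter]
    congr 1
    ext A
    simp only [Finset.mem_filter]
    tauto
  · refine Finset.card_nbij' (fun A => (A.filter (· ∉ D), A.subtype (· ∈ D)))
      (fun P => P.1 ∪ P.2.map (Function.Embedding.subtype _)) ?_ ?_ ?_ ?_
    · intro A hA
      simp only [Finset.coe_filter, Finset.mem_filter, Finset.mem_univ, true_and,
        Set.mem_ofPred_eq, not_forall, not_not] at hA
      obtain ⟨⟨hrA, hA⟩, d, hd, hdD⟩ := hA
      obtain ⟨hp, hv⟩ := hD.mem_and_mem_of_connected hA hrA hr hd hdD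
      have h1 := hD.connected_diff hA hp
      have h2 := hD.connected_inter hA hv
      simp only [Finset.coe_product, Set.mem_prod, Finset.mem_coe, Finset.mem_filter,
        Finset.mem_univ, true_and]
      refine ⟨⟨⟨⟨hrA, hr⟩, ⟨hp, hD.notMem⟩, by simp⟩, h1.induce_congr (by ext; simp)⟩,
        ?_, h2.induce_congr (by ext; simp)⟩
      simpa using hv
    · rintro ⟨B, C⟩ hBC
      simp only [Finset.coe_product, Set.mem_prod, Finset.mem_coe, Finset.mem_filter,
        Finset.mem_univ, true_and] at hBC
      obtain ⟨⟨⟨hrB, hpB, hB⟩, hBc⟩, hvC, hC⟩ := hBC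
      have h := hD.connected_union hBc hpB hC hvC
      simp only [Finset.mem_coe, Finset.mem_filter, Finset.mem_univ, true_and]
      refine ⟨⟨Finset.mem_union_left _ hrB, h.induce_congr (by ext; simp)⟩, fun hn => hn v ?_ hD.mem⟩
      refine Finset.mem_union_right _ (Finset.mem_map.2 ⟨_, hvC, rfl⟩)
    · intro A _
      ext x
      by_cases hx : x ∈ D <;> simp [hx]
    · rintro ⟨B, C⟩ hBC
      simp only [Finset.coe_product, Set.mem_prod, Finset.mem_coe, Finset.mem_filter,
        Finset.mem_univ, true_and] at hBC
      have hB := hBC.1.1.2.2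
      refine Prod.ext ?_ ?_
      · ext x
        by_cases hx : x ∈ D
        · simpa [hx] using fun h => hB x h hx
        · simp [hx]
      · ext ⟨x, hx⟩
        simpa [hx] using fun h => absurd hx (hB x h)

namespace SimpleGraph

variable {V : Type*}

/-- The graph obtained from `G` by replacing the edges inside `D` with those of `K`. -/
def graft (G : SimpleGraph V) (D : Set V) (K : SimpleGraph D) : SimpleGraph V where
  Adj x y := (∃ hx hy, K.Adj ⟨x, hx⟩ ⟨y, hy⟩) ∨ (¬(x ∈ D ∧ y ∈ D) ∧ G.Adj x y)
  symm := ⟨by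
    rintro x y (⟨hx, hy, h⟩ | ⟨h, h'⟩)
    · exact Or.inl ⟨hy, hx, h.symm⟩
    · exact Or.inr ⟨fun h'' => h h''.symm, h'.symm⟩⟩
  loopless := ⟨by
    rintro x (⟨hx, hy, h⟩ | ⟨h, h'⟩)
    · exact K.irrefl h
    · exact G.irrefl h'⟩

variable {G : SimpleGraph V} {D : Set V} {K : SimpleGraph D} {p v : V}

lemma graft_adj_of_mem {x y : V} (hx : x ∈ D) (hy : y ∈ D) :
    (G.graft D K).Adj x y ↔ K.Adj ⟨x, hx⟩ ⟨y, hy⟩ := by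
  simp [graft, hx, hy]

lemma graft_adj_of_not {x y : V} (h : ¬(x ∈ D ∧ y ∈ D)) :
    (G.graft D K).Adj x y ↔ G.Adj x y := by
  have : ¬∃ hx hy, K.Adj ⟨x, hx⟩ ⟨y, hy⟩ := fun ⟨hx, hy, _⟩ => h ⟨hx, hy⟩
  simp only [graft, this, h, not_false_eq_true, true_and, false_or]

lemma induce_graft : (G.graft D K).induce D = K := by
  ext ⟨x, hx⟩ ⟨y, hy⟩
  exact graft_adj_of_mem hx hy

lemma induce_graft_of_forall_notMem {A : Set V} (hA : ∀ x ∈ A, x ∉ D) :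
    (G.graft D K).induce A = G.induce A := by
  ext ⟨x, hx⟩ ⟨y, hy⟩
  exact graft_adj_of_not fun h => hA x hx h.1

namespace IsHanging

lemma graft (hD : G.IsHanging D p v) (K : SimpleGraph D) : (G.graft D K).IsHanging D p v where
  notMem := hD.notMem
  mem := hD.mem
  adj := (graft_adj_of_not fun h => hD.notMem h.1).2 hD.adj
  eq_and_eq x y hx hy h := hD.eq_and_eq x y hx hy ((graft_adj_of_not fun h => hx h.1).1 h)

open Classical in
lemma contraction_graft (hD : G.IsHanging D p v) (K : SimpleGraph D) (x y : V)
    (h : G.Adj x y) :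
    (if x ∈ D then p else x) = (if y ∈ D then p else y) ∨
      (G.graft D K).Adj (if x ∈ D then p else x) (if y ∈ D then p else y) := by
  by_cases h1 : x ∈ D <;> by_cases h2 : y ∈ D
  · simp [h1, h2]
  · simp [h1, (hD.eq_and_eq' h1 h2 h).1]
  · simp [h2, (hD.eq_and_eq x y h1 h2 h).1]
  · simp [h1, h2, graft_adj_of_not, h]

lemma connected_graft (hD : G.IsHanging D p v) (hG : G.Connected) (hK : K.Connected) :
    (G.graft D K).Connected := by
  classical
  have key (x : V) : (G.graft D K).Reachable x p := by
    by_cases hx : x ∈ D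
    · have h1 := (hK ⟨x, hx⟩ ⟨v, hD.mem⟩).of_contraction (H := G.graft D K) Subtype.val
        fun a b h => Or.inr ((graft_adj_of_mem a.2 b.2).2 h)
      exact h1.trans (hD.graft K).adj.symm.reachable
    · have h1 := (hG x p).of_contraction (H := G.graft D K) _ (hD.contraction_graft K)
      simpa [hx, hD.notMem] using h1
  have : Nonempty V := ⟨p⟩
  exact ⟨fun x y => (key x).trans (key y).symm⟩

lemma isAcyclic_graft (hD : G.IsHanging D p v) (hG : G.IsAcyclic) (hK : K.IsAcyclic) :
    (G.graft D K).IsAcyclic := by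
  classical
  have hD' := hD.graft K
  have cross : ∀ a b, a ∉ D → b ∈ D → (G.graft D K).Adj a b → (G.graft D K).IsBridge s(a, b) := by
    intro a b ha hb hab hr
    obtain ⟨rfl, rfl⟩ := hD'.eq_and_eq a b ha hb hab
    have h1 := hr.of_contraction (H := (⊥ : SimpleGraph Prop)) (· ∈ D) fun x y hxy => by
      left
      rw [deleteEdges_adj] at hxy
      by_cases h1 : x ∈ D <;> by_cases h2 : y ∈ D
      · simp [h1, h2]
      · obtain ⟨rfl, rfl⟩ := hD'.eq_and_eq' h1 h2 hxy.1
        exact absurd Sym2.eq_swap hxy.2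
      · obtain ⟨rfl, rfl⟩ := hD'.eq_and_eq x y h1 h2 hxy.1
        exact absurd rfl hxy.2
      · simp [h1, h2]
    rw [reachable_bot] at h1
    exact ha (h1 ▸ hb)
  rw [isAcyclic_iff_forall_adj_isBridge] at hG hK ⊢
  intro a b hab
  by_cases ha : a ∈ D <;> by_cases hb : b ∈ D
  · intro hr
    refine hK ((graft_adj_of_mem ha hb).1 hab) ?_
    have h1 := hr.of_contraction (H := K.deleteEdges {s(⟨a, ha⟩, ⟨b, hb⟩)})
      (fun x => if hx : x ∈ D then ⟨x, hx⟩ else ⟨v, hD.mem⟩) fun x y hxy => by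
        rw [deleteEdges_adj] at hxy
        by_cases h1 : x ∈ D <;> by_cases h2 : y ∈ D
        · right
          have := (graft_adj_of_mem h1 h2).1 hxy.1
          simpa [h1, h2, this] using hxy.2
        · simp [h2, (hD'.eq_and_eq' h1 h2 hxy.1).2]
        · simp [h1, (hD'.eq_and_eq x y h1 h2 hxy.1).2]
        · simp [h1, h2]
    simpa [ha, hb] using h1
  · rw [Sym2.eq_swap]
    exact cross b a hb ha hab.symm
  · exact cross a b ha hb hab
  · intro hr
    refine hG ((graft_adj_of_not fun h => ha h.1).1 hab) ?_
    have h1 := hr.of_contraction (H := G.deleteEdges {s(a, b)})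
      (fun x => if x ∈ D then p else x) fun x y hxy => by
        rw [deleteEdges_adj] at hxy
        by_cases h1 : x ∈ D <;> by_cases h2 : y ∈ D
        · simp [h1, h2]
        · simp [h1, (hD'.eq_and_eq' h1 h2 hxy.1).1]
        · simp [h2, (hD'.eq_and_eq x y h1 h2 hxy.1).1]
        · right
          have := (graft_adj_of_not (K := K) fun h => h1 h.1).1 hxy.1
          simpa [h1, h2, this] using hxy.2
    simpa [ha, hb] using h1

lemma isTree_graft (hD : G.IsHanging D p v) (hG : G.IsTree) (hK : K.IsTree) :
    (G.graft D K).IsTree :=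
  ⟨hD.connected_graft hG.connected hK.connected, hD.isAcyclic_graft hG.isAcyclic hK.isAcyclic⟩

lemma dist_graft_le_of_notMem (hD : G.IsHanging D p v) (hG : G.Connected) {x y : V}
    (hx : x ∉ D) (hy : y ∉ D) : (G.graft D K).dist x y ≤ G.dist x y := by
  classical
  simpa [hx, hy] using hG.dist_le_of_contraction _ (hD.contraction_graft K) x y

lemma dist_graft_le_of_mem (hD : G.IsHanging D p v) (hG : G.Connected) (hK : K.Connected)
    {x y : V} (hx : x ∉ D) (hy : y ∈ D) :
    (G.graft D K).dist x y ≤ G.dist x p + 1 + K.dist ⟨v, hD.mem⟩ ⟨y, hy⟩ := by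
  have hc := hD.connected_graft hG hK
  have h1 := hc.dist_triangle (u := x) (v := p) (w := y)
  have h2 := hc.dist_triangle (u := p) (v := v) (w := y)
  have h3 := hD.dist_graft_le_of_notMem (K := K) hG hx hD.notMem
  have h4 := dist_eq_one_iff_adj.2 (hD.graft K).adj
  have h5 := hK.dist_le_of_contraction (H := G.graft D K) Subtype.val
    (fun a b h => Or.inr ((graft_adj_of_mem a.2 b.2).2 h)) ⟨v, hD.mem⟩ ⟨y, hy⟩
  simp only at h5
  omega

lemma subtreeCount_le_of_subtreeCount_graft_le [Fintype V] [Fintype D] {r : V}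
    (hD : G.IsHanging D p v) (hG : G.Connected) (hr : r ∉ D)
    (h : subtreeCount G r ≤ subtreeCount (G.graft D K) r) :
    subtreeCount (G.induce D) ⟨v, hD.mem⟩ ≤ subtreeCount K ⟨v, hD.mem⟩ := by
  classical
  rw [hD.subtreeCount_eq hr, (hD.graft K).subtreeCount_eq hr, induce_graft] at h
  have e (P : Finset V → Prop) (hP : ∀ A, P A → ∀ x ∈ A, x ∉ D) :
      Nat.card {A : Finset V // P A ∧ ((G.graft D K).induce (A : Set V)).Connected} =
      Nat.card {A : Finset V // P A ∧ (G.induce (A : Set V)).Connected} := by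
    refine Nat.card_congr (Equiv.subtypeEquivRight fun A => and_congr_right fun hA => ?_)
    rw [induce_graft_of_forall_notMem (by simpa using hP A hA)]
  rw [e _ fun A hA => hA.2, e _ fun A hA => hA.2.2] at h
  refine Nat.le_of_mul_le_mul_left (Nat.le_of_add_le_add_left h) ?_
  have hc := hD.connected_diff (A := Set.univ)
    ((induceUnivIso G).connected_iff.2 hG) (Set.mem_univ _)
  refine Nat.card_pos_iff.2 ⟨⟨⟨Finset.univ.filter (· ∉ D), ?_, ?_⟩⟩, inferInstance⟩
  · simp [hr, hD.notMem]
  · exact hc.induce_congr (by ext; simp)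

end IsHanging

end SimpleGraph

lemma exists_equiv_fin_ncard_apply_eq {V : Type*} [Finite V] {D : Set V} (x : D)
    (s : Fin D.ncard) : ∃ e : D ≃ Fin D.ncard, e x = s := by
  classical
  let e₀ : D ≃ Fin D.ncard := Finite.equivFinOfCardEq rfl
  exact ⟨e₀.trans (Equiv.swap (e₀ x) s), by simp⟩

lemma subtreeCount_le_of_forall_fin {n h c : ℕ}
    (hopt : ∀ (H : SimpleGraph (Fin n)) (s : Fin n), H.IsTree →
      (∀ w, H.dist s w ≤ h) → c ≤ subtreeCount H s)
    {W : Type*} [Fintype W] (hW : Nat.card W = n) {H : SimpleGraph W} (hH : H.IsTree) (s : W)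
    (hs : ∀ w, H.dist s w ≤ h) : c ≤ subtreeCount H s := by
  let e : W ≃ Fin n := Finite.equivFinOfCardEq hW
  let φ : H.comap e.symm ≃g H := SimpleGraph.Iso.comap e.symm H
  have := hopt (H.comap e.symm) (e s) (φ.isTree_iff.2 hH) fun w => by
    have hw := hH.connected.dist_le_of_contraction (H := H.comap e.symm) e
      (fun a b hab => Or.inr (by simpa using hab)) s (e.symm w)
    rw [e.apply_symm_apply] at hw
    exact hw.trans (hs _)
  rwa [subtreeCount_congr φ, show φ (e s) = s from e.symm_apply_apply s] at this

lemma SimpleGraph.IsHanging.subtreeCount_induce_le {V : Type*} [Fintype V] {G : SimpleGraph V}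
    {D : Set V} [Fintype D] {p v r : V} (hD : G.IsHanging D p v) (hG : G.IsTree)
    (hp : G.dist r p + 1 = G.dist r v) (hr : r ∉ D) {n h : ℕ} (hn : n = Nat.card V)
    (hheight : ∀ w, G.dist r w ≤ h)
    (hopt : ∀ (H : SimpleGraph (Fin n)) (s : Fin n), H.IsTree →
      (∀ w, H.dist s w ≤ h) → subtreeCount G r ≤ subtreeCount H s)
    {H : SimpleGraph (Fin D.ncard)} (hH : H.IsTree) (s : Fin D.ncard)
    (hs : ∀ w, H.dist s w ≤ h - G.dist r v) :
    subtreeCount (G.induce D) ⟨v, hD.mem⟩ ≤ subtreeCount H s := by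
  obtain ⟨e, he⟩ := exists_equiv_fin_ncard_apply_eq ⟨v, hD.mem⟩ s
  let φ : H.comap e ≃g H := SimpleGraph.Iso.comap e H
  have hK : (H.comap e).IsTree := φ.isTree_iff.2 hH
  refine (hD.subtreeCount_le_of_subtreeCount_graft_le (K := H.comap e) hG.connected hr ?_).trans_eq
    ((subtreeCount_congr φ _).trans (congrArg _ he))
  refine subtreeCount_le_of_forall_fin hopt hn.symm (hD.isTree_graft hG hK) r fun w => ?_
  by_cases hw : w ∈ D
  · have h1 := hD.dist_graft_le_of_mem hG.connected hK.connected hr hw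
    have h3 := hH.connected.dist_le_of_contraction (H := H.comap e) e.symm
      (fun a b hab => Or.inr (by simpa using hab)) s (e ⟨w, hw⟩)
    rw [← he, e.symm_apply_apply, e.symm_apply_apply, he] at h3
    have h4 := hs (e ⟨w, hw⟩)
    have h5 := hheight v
    omega
  · exact (hD.dist_graft_le_of_notMem hG.connected hr hw).trans (hheight w)

/-- in an optimal tree (minimizing root-containing subtrees among
rooted trees of order `n` and height at most `h`, with all leaves at height `h`),
every rooted subtree `T(v)` of descendants is itself optimal for its order and
height bound `h - h_T(v)`. -/
theorem optimal_subtree_optimal {V : Type*} [Fintype V] (G : SimpleGraph V)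
    (hT : G.IsTree) (r : V) (n h : ℕ) (hn : n = Fintype.card V)
    (hheight : ∀ w, G.dist r w ≤ h)
    (hleaf : ∀ w, w ≠ r → (G.neighborSet w).ncard = 1 → G.dist r w = h)
    (hopt : ∀ (H : SimpleGraph (Fin n)) (s : Fin n), H.IsTree →
      (∀ w, H.dist s w ≤ h) → subtreeCount G r ≤ subtreeCount H s)
    (v : V) :
    ∀ (H : SimpleGraph (Fin (({w | G.dist r w = G.dist r v + G.dist v w} : Set V).ncard)))
      (s : Fin (({w | G.dist r w = G.dist r v + G.dist v w} : Set V).ncard)),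
      H.IsTree → (∀ w, H.dist s w ≤ h - G.dist r v) →
      subtreeCount (G.induce {w | G.dist r w = G.dist r v + G.dist v w})
          ⟨v, by simp⟩ ≤ subtreeCount H s := by
  intro H s hH hs
  obtain rfl | hvr := eq_or_ne v r
  · have huniv : {w | G.dist v w = G.dist v v + G.dist v w} = Set.univ := by ext; simp
    have hcard : Nat.card (Fin {w | G.dist v w = G.dist v v + G.dist v w}.ncard) = n := by
      rw [Nat.card_fin, huniv, Set.ncard_univ, hn, Nat.card_eq_fintype_card]
    let φ : G.induce {w | G.dist v w = G.dist v v + G.dist v w} ≃g G :=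
      ⟨Equiv.subtypeUnivEquiv (by simp), Iff.rfl⟩
    rw [subtreeCount_congr φ]
    exact subtreeCount_le_of_forall_fin hopt hcard hH s (by simpa using hs)
  · obtain ⟨p, hpv, hp⟩ := hT.connected.exists_adj_dist_add_one_eq hvr
    have hD := hT.isHanging_descendants hpv hp
    have := hT.connected.pos_dist_of_ne hvr
    exact hD.subtreeCount_induce_le hT hp (by simp; omega)
      (hn.trans Nat.card_eq_fintype_card.symm) hheight hopt hH s hs
end

section
/- Every leaf of an optimal rooted tree (one minimizing the number of root-containing subtrees among rooted trees of given order n and height at most h) has height exactly h, provided n ≥ h+1. -/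
open SimpleGraph Finset

section ParentMaps

variable {V W : Type*}

theorem subtreeCount_eq_of_iso [Fintype V] [Fintype W] {G : SimpleGraph V} {H : SimpleGraph W}
    (e : G ≃g H) (v : V) : subtreeCount G v = subtreeCount H (e v) := by
  refine Nat.card_congr (Equiv.subtypeEquiv e.toEquiv.finsetCongr fun A => ?_)
  have hmem : e v ∈ e.toEquiv.finsetCongr A ↔ v ∈ A :=
    Finset.mem_map' e.toEquiv.toEmbedding
  have hbij : Set.BijOn e (A : Set V) (e.toEquiv.finsetCongr A : Finset W) := by
    refine ⟨fun a ha => ?_, e.injective.injOn, fun b hb => ?_⟩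
    · simpa [Equiv.finsetCongr_apply] using ha
    · simpa [Equiv.finsetCongr_apply] using hb
  rw [hmem, (e.induce hbij).connected_iff]

theorem dist_iso_le {G : SimpleGraph V} {H : SimpleGraph W} (e : G ≃g H) (hG : G.Connected)
    (u v : V) : H.dist (e u) (e v) ≤ G.dist u v := by
  obtain ⟨p, hp⟩ := hG.exists_walk_length_eq_dist u v
  rw [← hp, ← Walk.length_map e.toHom p]
  exact dist_le _

/-- `x` is obtained from `v` by iterating the parent map `f`. -/
def IsAncestor (f : V → V) (x v : V) : Prop := ∃ k, f^[k] v = x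

theorem IsAncestor.refl (f : V → V) (x : V) : IsAncestor f x x := ⟨0, rfl⟩

theorem IsAncestor.of_parent {f : V → V} {x v : V} (h : IsAncestor f x (f v)) :
    IsAncestor f x v := by
  obtain ⟨k, hk⟩ := h
  exact ⟨k + 1, by rwa [Function.iterate_succ_apply]⟩

theorem IsAncestor.parent {f : V → V} {x v : V} (h : IsAncestor f x v) (hne : v ≠ x) :
    IsAncestor f x (f v) := by
  obtain ⟨_ | k, hk⟩ := h
  · exact absurd hk hne
  · exact ⟨k, by rwa [Function.iterate_succ_apply] at hk⟩

/-- `f` is the parent map of a tree with root `r`, and `ht` measures the distance to the root. -/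
structure IsParentMap (f : V → V) (r : V) (ht : V → ℕ) : Prop where
  root : f r = r
  height_root : ht r = 0
  height_succ : ∀ v, v ≠ r → ht (f v) + 1 = ht v

/-- The graph joining every vertex to its parent. -/
def parentGraph (f : V → V) : SimpleGraph V := SimpleGraph.fromRel fun a b => f a = b

namespace IsParentMap

variable {f : V → V} {r : V} {ht : V → ℕ}

theorem ne_parent (hf : IsParentMap f r ht) {v : V} (hv : v ≠ r) : v ≠ f v := by
  intro h
  have := hf.height_succ v hv
  rw [← h] at this
  omega

theorem adj (hf : IsParentMap f r ht) {v : V} (hv : v ≠ r) : (parentGraph f).Adj v (f v) := by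
  simp [parentGraph, hf.ne_parent hv]

theorem height_le_of_isAncestor (hf : IsParentMap f r ht) {x v : V} (h : IsAncestor f x v) :
    ht x ≤ ht v := by
  obtain ⟨k, rfl⟩ := h
  induction k generalizing v with
  | zero => rfl
  | succ k ih =>
    rw [Function.iterate_succ_apply]
    refine ih.trans ?_
    by_cases hv : v = r
    · rw [hv, hf.root]
    · have := hf.height_succ v hv
      omega

theorem eq_of_isAncestor (hf : IsParentMap f r ht) {x v : V} (h : IsAncestor f x v)
    (hle : ht v ≤ ht x) : v = x := by
  by_contra hne
  have hx := hf.height_le_of_isAncestor (h.parent hne)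
  by_cases hv : v = r
  · obtain ⟨k, hk⟩ := h
    rw [hv, Function.iterate_fixed hf.root] at hk
    exact hne (hv.trans hk)
  · have := hf.height_succ v hv
    omega

theorem isAncestor_root (hf : IsParentMap f r ht) (v : V) : IsAncestor f r v := by
  induction hk : ht v generalizing v with
  | zero =>
    by_cases hv : v = r
    · exact hv ▸ IsAncestor.refl f v
    · have := hf.height_succ v hv
      omega
  | succ k ih =>
    by_cases hv : v = r
    · exact hv ▸ IsAncestor.refl f v
    · have := hf.height_succ v hv
      exact (ih (f v) (by omega)).of_parent

theorem induce_connected (hf : IsParentMap f r ht) {G : SimpleGraph V}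
    (hG : ∀ v, v ≠ r → G.Adj v (f v)) {A : Set V} (hr : r ∈ A) (hA : ∀ a ∈ A, f a ∈ A) :
    (G.induce A).Connected := by
  rw [connected_iff_exists_forall_reachable]
  refine ⟨⟨r, hr⟩, ?_⟩
  rintro ⟨a, ha⟩
  obtain ⟨k, hk⟩ := hf.isAncestor_root a
  induction k generalizing a with
  | zero =>
    subst hk
    exact Reachable.refl _
  | succ k ih =>
    by_cases har : a = r
    · subst har
      exact Reachable.refl _
    · refine (ih (f a) (hA a ha) hk).trans (Adj.reachable ?_)
      exact (hG a har).symm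

theorem connected (hf : IsParentMap f r ht) : (parentGraph f).Connected :=
  (induceUnivIso _).connected_iff.1
    (hf.induce_connected (fun _ hv => hf.adj hv) (Set.mem_univ r) fun _ _ => Set.mem_univ _)

theorem isTree [Fintype V] (hf : IsParentMap f r ht) : (parentGraph f).IsTree := by
  classical
  refine isTree_iff_connected_and_card.2 ⟨hf.connected, ?_⟩
  refine le_antisymm ?_ hf.connected.card_vert_le_card_edgeSet_add_one
  have hsub : (parentGraph f).edgeSet ⊆
      ((Finset.univ.erase r).image fun v => s(v, f v) : Finset (Sym2 V)) := by
    intro e he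
    induction e with
    | _ a b =>
      have key : ∀ a b : V, a ≠ b → f a = b → a ≠ r := by
        rintro a b hab h rfl
        exact hab (hf.root.symm.trans h)
      rw [mem_edgeSet, parentGraph, fromRel_adj] at he
      obtain ⟨hab, h | h⟩ := he
      · simp only [coe_image, Set.mem_image]
        exact ⟨a, by simpa using key a b hab h, by rw [h]⟩
      · simp only [coe_image, Set.mem_image]
        exact ⟨b, by simpa using key b a hab.symm h, by rw [h, Sym2.eq_swap]⟩
  have h1 := Set.ncard_le_ncard hsub (Finset.finite_toSet _)
  rw [Set.ncard_coe_finset] at h1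
  have h2 := h1.trans Finset.card_image_le
  rw [Finset.card_erase_of_mem (Finset.mem_univ r), Finset.card_univ] at h2
  have h3 : 0 < Fintype.card V := Fintype.card_pos_iff.2 ⟨r⟩
  rw [← Nat.card_coe_set_eq] at h2
  rw [Nat.card_eq_fintype_card (α := V)]
  omega

theorem dist_le_height (hf : IsParentMap f r ht) (v : V) : (parentGraph f).dist r v ≤ ht v := by
  obtain ⟨k, hk⟩ := hf.isAncestor_root v
  induction k generalizing v with
  | zero =>
    subst hk
    simp
  | succ k ih =>
    by_cases hv : v = r
    · simp [hv]
    · have h1 := ih (f v) hk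
      have h2 := hf.connected.dist_triangle (u := r) (v := f v) (w := v)
      have h3 := dist_eq_one_iff_adj.2 (hf.adj hv).symm
      have h4 := hf.height_succ v hv
      omega

theorem parent_mem_of_connected (hf : IsParentMap f r ht) {A : Set V} (hr : r ∈ A)
    (hA : ((parentGraph f).induce A).Connected) : ∀ a ∈ A, f a ∈ A := by
  intro a ha
  by_contra hfa
  have har : a ≠ r := by
    rintro rfl
    exact hfa (hf.root.symm ▸ hr)
  have hdesc : ∀ u : A, ((parentGraph f).induce A).Reachable ⟨a, ha⟩ u → IsAncestor f a u := by
    rintro u ⟨p⟩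
    generalize hs : (⟨a, ha⟩ : A) = s at p
    have hs' : IsAncestor f a s := by
      rw [← hs]
      exact IsAncestor.refl f a
    clear hs
    induction p with
    | nil => exact hs'
    | @cons b c d hbc _ ih =>
      refine ih ?_
      have hadj : (parentGraph f).Adj b c := hbc
      rw [parentGraph, fromRel_adj] at hadj
      obtain ⟨-, h | h⟩ := hadj
      · have hba : (b : V) ≠ a := by
          intro hba
          rw [hba] at h
          exact hfa (h ▸ c.2)
        exact h ▸ hs'.parent hba
      · exact IsAncestor.of_parent (h.symm ▸ hs')
  obtain ⟨k, hk⟩ := hdesc ⟨r, hr⟩ (hA.preconnected _ _)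
  rw [Function.iterate_fixed hf.root] at hk
  exact har hk.symm

open Classical in
/-- Making `x` a child of its sibling `y` lowers the subtree of `x` by one level. -/
theorem update_sibling (hf : IsParentMap f r ht) {x y : V} (hxy : x ≠ y) (hxr : x ≠ r)
    (hht : ht x = ht y) :
    IsParentMap (Function.update f x y) r
      (fun v => ht v + if IsAncestor f x v then 1 else 0) where
  root := by rw [Function.update_of_ne hxr.symm, hf.root]
  height_root := by
    rw [if_neg, hf.height_root]
    rintro ⟨k, hk⟩
    rw [Function.iterate_fixed hf.root] at hk
    exact hxr hk.symm
  height_succ := by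
    intro v hv
    by_cases hvx : v = x
    · subst hvx
      have hy : ¬ IsAncestor f v y := fun h => hxy (hf.eq_of_isAncestor h hht.ge).symm
      simp [hy, IsAncestor.refl, hht]
    · have hiff : IsAncestor f x (f v) ↔ IsAncestor f x v :=
        ⟨IsAncestor.of_parent, fun h => h.parent hvx⟩
      have := hf.height_succ v hv
      simp only [Function.update_of_ne hvx, hiff]
      omega

open Classical in
theorem subtreeCount_update_sibling_lt [Fintype V] (hf : IsParentMap f r ht) {G : SimpleGraph V}
    (hG : ∀ v, v ≠ r → G.Adj v (f v)) {x y : V} (hxy : x ≠ y) (hxr : x ≠ r)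
    (hht : ht x = ht y) (hpar : f x = f y) :
    subtreeCount (parentGraph (Function.update f x y)) r < subtreeCount G r := by
  have hf' := hf.update_sibling hxy hxr hht
  have hclosed : ∀ A : Finset V, r ∈ A →
      ((parentGraph (Function.update f x y)).induce (A : Set V)).Connected →
      ∀ a ∈ (A : Set V), Function.update f x y a ∈ (A : Set V) :=
    fun A hr hA => hf'.parent_mem_of_connected hr hA
  refine Set.ncard_lt_ncard (s := {A : Finset V | r ∈ A ∧
    ((parentGraph (Function.update f x y)).induce (A : Set V)).Connected})
    (t := {A : Finset V | r ∈ A ∧ (G.induce (A : Set V)).Connected}) ?_ (Set.toFinite _)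
  refine (Set.ssubset_iff_of_subset ?_).2 ?_
  · rintro A ⟨hr, hA⟩
    have hc := hclosed A hr hA
    refine ⟨hr, hf.induce_connected hG hr fun a ha => ?_⟩
    by_cases hax : a = x
    · have hy : y ∈ (A : Set V) := by simpa [hax] using hc a ha
      have := hc y hy
      rwa [Function.update_of_ne hxy.symm, ← hpar, ← hax] at this
    · simpa [Function.update_of_ne hax] using hc a ha
  · refine ⟨Finset.univ.filter fun u => IsAncestor f u x, ⟨?_, ?_⟩, ?_⟩
    · simpa using hf.isAncestor_root x
    · refine hf.induce_connected hG (by simpa using hf.isAncestor_root x) fun a ha => ?_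
      simp only [coe_filter, Finset.mem_univ, true_and, Set.mem_ofPred_eq] at ha ⊢
      obtain ⟨k, rfl⟩ := ha
      exact ⟨k + 1, Function.iterate_succ_apply' f k x⟩
    · rintro ⟨hr, hA⟩
      have := hclosed _ hr hA x (by simpa using IsAncestor.refl f x)
      simp only [Function.update_self, coe_filter, Finset.mem_univ, true_and,
        Set.mem_ofPred_eq] at this
      exact hxy (hf.eq_of_isAncestor this hht.le)

theorem exists_child_isAncestor (hf : IsParentMap f r ht) {c u : V} (h : IsAncestor f c u)
    (hne : u ≠ c) : ∃ w, w ≠ r ∧ f w = c ∧ IsAncestor f w u := by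
  obtain ⟨k, hk⟩ := h
  induction k generalizing u with
  | zero => exact absurd hk hne
  | succ k ih =>
    by_cases hfu : f u = c
    · refine ⟨u, ?_, hfu, IsAncestor.refl f u⟩
      rintro rfl
      exact hne (hf.root.symm.trans hfu)
    · obtain ⟨w, hwr, hw, hwu⟩ := ih hfu hk
      exact ⟨w, hwr, hw, hwu.of_parent⟩

/-- If all siblings have descendants at height `h`, then so does every vertex. -/
theorem exists_descendant_of_siblings [Fintype V] (hf : IsParentMap f r ht) {h : ℕ}
    (hcard : h + 1 ≤ Fintype.card V) (hle : ∀ v, ht v ≤ h)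
    (hsib : ∀ x y, x ≠ y → x ≠ r → ht x = ht y → f x = f y →
      ∃ u, IsAncestor f x u ∧ ht u = h) (v : V) :
    ∃ u, IsAncestor f v u ∧ ht u = h := by
  have hroot : ∃ u, ht u = h := by
    by_contra! hno
    have hinj : ∀ k, ∀ x y, ht x = k → ht y = k → x = y := by
      have hzero : ∀ x, ht x = 0 → x = r := by
        intro x hx
        by_contra hxr
        have := hf.height_succ x hxr
        omega
      intro k
      induction k with
      | zero => exact fun x y hx hy => (hzero x hx).trans (hzero y hy).symm
      | succ k ih =>
        intro x y hx hy
        by_contra hxy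
        have hxr : x ≠ r := fun h => by rw [h, hf.height_root] at hx; omega
        have hyr : y ≠ r := fun h => by rw [h, hf.height_root] at hy; omega
        have h1 := hf.height_succ x hxr
        have h2 := hf.height_succ y hyr
        obtain ⟨u, -, hu⟩ := hsib x y hxy hxr (hx.trans hy.symm)
          (ih _ _ (by omega) (by omega))
        exact hno u hu
    have := Finset.card_le_card_of_injOn (s := Finset.univ) (t := Finset.range h) ht
      (fun a _ => by simpa using lt_of_le_of_ne (hle a) (hno a))
      (fun a _ b _ hab => hinj _ a b hab rfl)
    rw [Finset.card_univ, Finset.card_range] at this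
    omega
  obtain ⟨k, hk⟩ := hf.isAncestor_root v
  induction k generalizing v with
  | zero =>
    subst hk
    obtain ⟨u, hu⟩ := hroot
    exact ⟨u, hf.isAncestor_root u, hu⟩
  | succ k ih =>
    by_cases hvr : v = r
    · subst hvr
      obtain ⟨u, hu⟩ := hroot
      exact ⟨u, hf.isAncestor_root u, hu⟩
    · obtain ⟨u, hanc, hu⟩ := ih (f v) hk
      have hv := hf.height_succ v hvr
      have hne : u ≠ f v := by
        rintro rfl
        have := hle v
        omega
      obtain ⟨w, hwr, hw, hwu⟩ := hf.exists_child_isAncestor hanc hne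
      by_cases hvw : v = w
      · exact ⟨u, hvw ▸ hwu, hu⟩
      · have hw' := hf.height_succ w hwr
        rw [hw] at hw'
        exact hsib v w hvw hvr (by omega) hw.symm

end IsParentMap

theorem exists_isParentMap_of_connected {G : SimpleGraph V} (hG : G.Connected) (r : V) :
    ∃ f : V → V, IsParentMap f r (G.dist r) ∧ ∀ v, v ≠ r → G.Adj v (f v) := by
  have hstep : ∀ v, ∃ w, (v = r → w = r) ∧
      (v ≠ r → G.Adj v w ∧ G.dist r w + 1 = G.dist r v) := by
    intro v
    by_cases hv : v = r
    · exact ⟨r, fun _ => rfl, fun h => absurd hv h⟩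
    · obtain ⟨p, hp⟩ := hG.exists_walk_length_eq_dist v r
      cases p with
      | nil => exact absurd rfl hv
      | @cons _ w _ hvw q =>
        refine ⟨w, fun h => absurd h hv, fun _ => ⟨hvw, ?_⟩⟩
        have h1 := dist_le q
        have h2 := hG.dist_triangle (u := r) (v := w) (w := v)
        have h3 := dist_eq_one_iff_adj.2 hvw.symm
        rw [Walk.length_cons, dist_comm] at hp
        rw [dist_comm] at h1
        omega
  choose f hroot hf using hstep
  exact ⟨f, ⟨hroot r rfl, dist_self, fun v hv => (hf v hv).2⟩, fun v hv => (hf v hv).1⟩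

theorem subtreeCount_le_of_optimal [Fintype V] {c h n : ℕ} (hn : n = Fintype.card V)
    (hopt : ∀ (H : SimpleGraph (Fin n)) (s : Fin n), H.IsTree →
      (∀ w, H.dist s w ≤ h) → c ≤ subtreeCount H s)
    {G : SimpleGraph V} (hG : G.IsTree) {r : V} (hr : ∀ w, G.dist r w ≤ h) :
    c ≤ subtreeCount G r := by
  let e : G ≃g _ := Iso.map (Fintype.equivFinOfCardEq hn.symm) G
  rw [subtreeCount_eq_of_iso e r]
  refine hopt _ _ (e.isTree_iff.1 hG) fun w => ?_
  obtain ⟨v, rfl⟩ := e.surjective w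
  exact (dist_iso_le e hG.connected r v).trans (hr v)

end ParentMaps

/-- every leaf of an optimal rooted tree of order `n ≥ h+1` and
height at most `h` has height exactly `h`. -/
theorem optimal_leaf_height {V : Type*} [Fintype V] (G : SimpleGraph V)
    (hT : G.IsTree) (r : V) (n h : ℕ) (hn : n = Fintype.card V) (hnh : h + 1 ≤ n)
    (hheight : ∀ w, G.dist r w ≤ h)
    (hopt : ∀ (H : SimpleGraph (Fin n)) (s : Fin n), H.IsTree →
      (∀ w, H.dist s w ≤ h) → subtreeCount G r ≤ subtreeCount H s) :
    ∀ v, v ≠ r → (G.neighborSet v).ncard = 1 → G.dist r v = h := by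
  classical
  intro v hvr hleaf
  obtain ⟨f, hf, hadj⟩ := exists_isParentMap_of_connected hT.connected r
  have hsib : ∀ x y, x ≠ y → x ≠ r → G.dist r x = G.dist r y → f x = f y →
      ∃ u, IsAncestor f x u ∧ G.dist r u = h := by
    intro x y hxy hxr hht hpar
    by_contra! hno
    refine absurd (subtreeCount_le_of_optimal hn hopt (hf.update_sibling hxy hxr hht).isTree
      fun w => ?_) (hf.subtreeCount_update_sibling_lt hadj hxy hxr hht hpar).not_ge
    refine ((hf.update_sibling hxy hxr hht).dist_le_height w).trans ?_
    have hw := hheight w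
    split_ifs with hx
    · have := hno w hx
      omega
    · omega
  obtain ⟨u, hvu, hu⟩ := hf.exists_descendant_of_siblings (hn ▸ hnh) hheight hsib v
  by_cases huv : u = v
  · rwa [huv] at hu
  · obtain ⟨w, hwr, hw, -⟩ := hf.exists_child_isAncestor hvu huv
    obtain ⟨a, ha⟩ := Set.ncard_eq_one.1 hleaf
    have h1 : f v ∈ G.neighborSet v := hadj v hvr
    have h2 : w ∈ G.neighborSet v := by
      have := hadj w hwr
      rw [hw] at this
      exact this.symm
    rw [ha, Set.mem_singleton_iff] at h1 h2
    have h3 := hf.height_succ v hvr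
    have h4 := hf.height_succ w hwr
    rw [hw] at h4
    rw [h1] at h3
    rw [h2] at h4
    omega
end
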